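/- With a supermetric as in the context and A a unital associative ℂ-algebra, assume ω ≠ 0 and let G be an I-indexed square matrix with entries in A satisfying: (a) G₁·(Σ12·G₂·Σ12) − (Σ12·G₂·Σ12)·G₁ = (εP − K)·(Σ12·G₂·Σ12) − (Σ12·G₂·Σ12)·(εP − K); (b) K·(G₁ + Σ12·G₂·Σ12) = 0 = (G₁ + Σ12·G₂·Σ12)·K; (c) the quadratic characteristic identity G·G + β·G − (ε/ω)·str(G·G)·Id = 0, where str(X) := Σ_a (−1)^{[a]} X^a_a ∈ A. Then for every α ∈ ℂ the linear L-operator L(u) := (u+α)·Id + G satisfies the graded RLL relation R(u−v)·L₁(u)·Σ12·L₂(v)·Σ12 = Σ12·L₂(v)·Σ12·L₁(u)·R(u−v) for all u, v ∈ ℂ. -/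

import Mathlib

/-- The sign (−1)^x for a parity x ∈ ZMod 2. -/
noncomputable def sg (x : ZMod 2) : ℂ := if x = 0 then 1 else -1

/-- The algebraic core of the linear evaluation: in any ℂ-algebra, the RLL relation follows from
the commutation relation, the K-symmetry and the characteristic identity. -/
theorem rll_of_relations {M : Type*} [Ring M] [Algebra ℂ M] {P K X Y : M} {ε β : ℂ}
    (hPX : P * X = Y * P) (hXP : X * P = P * Y)
    (hcomm : X * Y - Y * X = (ε • P - K) * Y - Y * (ε • P - K))
    (hKX : K * (X + Y) = 0) (hXK : (X + Y) * K = 0)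
    (hquad : K * (Y * Y + β • Y) = (Y * Y + β • Y) * K) (x y : ℂ) :
    (((x - y) * (x - y + β)) • (1 : M) - (ε * (x - y + β)) • P + (x - y) • K) *
        (x • (1 : M) + X) * (y • (1 : M) + Y) =
      (y • (1 : M) + Y) * (x • (1 : M) + X) *
        (((x - y) * (x - y + β)) • (1 : M) - (ε * (x - y + β)) • P + (x - y) • K) := by
  have hPXY : P * (X * Y) = Y * (X * P) := by rw [← mul_assoc, hPX, mul_assoc, hXP]
  have hKX' : K * X = -(K * Y) := eq_neg_of_add_eq_zero_left (by rw [← mul_add, hKX])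
  have hXK' : X * K = -(Y * K) := eq_neg_of_add_eq_zero_left (by rw [← add_mul, hXK])
  have hKXY : K * (X * Y) = -(K * (Y * Y)) := by
    rw [← mul_assoc, hKX', neg_mul, mul_assoc]
  have hYXK : Y * (X * K) = -(Y * (Y * K)) := by rw [hXK', mul_neg]
  have hXY : X * Y = Y * X + ε • (P * Y) - K * Y - ε • (Y * P) + Y * K := by
    rw [sub_eq_iff_eq_add] at hcomm
    rw [hcomm, sub_mul, mul_sub, smul_mul_assoc, mul_smul_comm]
    abel
  have hKYY : K * (Y * Y) = Y * (Y * K) + β • (Y * K) - β • (K * Y) := by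
    rw [mul_add, add_mul, mul_smul_comm, smul_mul_assoc, mul_assoc] at hquad
    rw [← hquad]
    abel
  simp only [mul_add, add_mul, mul_sub, sub_mul, smul_mul_assoc, mul_smul_comm, one_mul, mul_one,
    mul_assoc, hPXY, hKXY, hYXK]
  simp only [hPX, hXP, hKX', hXK', hKYY, hXY]
  module

section TensorLegs

variable {I A : Type*} [DecidableEq I]

/-- The matrix `X ⊗ Id`. -/
def firstLeg [Zero A] (X : Matrix I I A) : Matrix (I × I) (I × I) A :=
  Matrix.of fun a b => if a.2 = b.2 then X a.1 b.1 else 0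

/-- The matrix `Id ⊗ X`. -/
def secondLeg [Zero A] (X : Matrix I I A) : Matrix (I × I) (I × I) A :=
  Matrix.of fun a b => if a.1 = b.1 then X a.2 b.2 else 0

theorem secondLeg_smul_one [Ring A] (c : A) :
    secondLeg (c • (1 : Matrix I I A)) = c • (1 : Matrix (I × I) (I × I) A) := by
  ext ⟨a, b⟩ ⟨a', b'⟩
  by_cases h : a = a' <;> simp [secondLeg, Matrix.one_apply, Prod.ext_iff, h]

variable [Ring A] [Algebra ℂ A]

theorem firstLeg_smul_one_add (z : ℂ) (X : Matrix I I A) :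
    firstLeg (z • (1 : Matrix I I A) + X) = z • (1 : Matrix (I × I) (I × I) A) + firstLeg X := by
  ext ⟨a, b⟩ ⟨c, d⟩
  by_cases h : b = d <;> simp [firstLeg, Matrix.one_apply, Prod.ext_iff, h]

theorem secondLeg_smul_one_add (z : ℂ) (X : Matrix I I A) :
    secondLeg (z • (1 : Matrix I I A) + X) = z • (1 : Matrix (I × I) (I × I) A) + secondLeg X := by
  ext ⟨a, b⟩ ⟨c, d⟩
  by_cases h : a = c <;> simp [secondLeg, Matrix.one_apply, Prod.ext_iff, h]

theorem secondLeg_mul_self_add_smul [Fintype I] (β : ℂ) (X : Matrix I I A) :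
    secondLeg X * secondLeg X + β • secondLeg X = secondLeg (X * X + β • X) := by
  ext ⟨a, b⟩ ⟨c, d⟩
  by_cases h : a = c <;> simp [secondLeg, Matrix.mul_apply, Fintype.sum_prod_type, h]

end TensorLegs

theorem sg_mul_self (x : ZMod 2) : sg x * sg x = 1 := by
  unfold sg
  split_ifs <;> norm_num

section GradedOperators

variable {I : Type*} [DecidableEq I] (A : Type*) [Ring A] [Algebra ℂ A]

/-- The sign operator `Σ12`, with entries in `A`. -/
noncomputable def signOp (p : I → ZMod 2) : Matrix (I × I) (I × I) A :=
  Matrix.of fun a b => algebraMap ℂ A (sg (p a.1 * p a.2) * (if a = b then 1 else 0))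

/-- The superpermutation, with entries in `A`. -/
noncomputable def superPerm (p : I → ZMod 2) : Matrix (I × I) (I × I) A :=
  Matrix.of fun a b => algebraMap ℂ A
    (sg (p a.1 * p a.2) * (if a.1 = b.2 then 1 else 0) * (if a.2 = b.1 then 1 else 0))

theorem signOp_eq_diagonal (p : I → ZMod 2) :
    signOp A p = Matrix.diagonal fun a => algebraMap ℂ A (sg (p a.1 * p a.2)) := by
  ext a b
  by_cases h : a = b <;> simp [signOp, h]

variable [Fintype I]

theorem signOp_mul_self (p : I → ZMod 2) : signOp A p * signOp A p = 1 := by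
  rw [signOp_eq_diagonal, Matrix.diagonal_mul_diagonal]
  simp [← map_mul, sg_mul_self]

variable {A}

theorem superPerm_mul_apply (p : I → ZMod 2) (M : Matrix (I × I) (I × I) A) (a b : I × I) :
    (superPerm A p * M) a b = algebraMap ℂ A (sg (p a.1 * p a.2)) * M a.swap b := by
  rw [Matrix.mul_apply, Finset.sum_eq_single a.swap]
  · simp [superPerm]
  · rintro c - hc
    have : ¬ (a.1 = c.2 ∧ a.2 = c.1) := fun h => hc (Prod.ext h.2.symm h.1.symm)
    by_cases h : a.1 = c.2 <;> simp_all [superPerm]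
  · simp

theorem mul_superPerm_apply (p : I → ZMod 2) (M : Matrix (I × I) (I × I) A) (a b : I × I) :
    (M * superPerm A p) a b = M a b.swap * algebraMap ℂ A (sg (p b.1 * p b.2)) := by
  rw [Matrix.mul_apply, Finset.sum_eq_single b.swap]
  · simp [superPerm, mul_comm]
  · rintro c - hc
    have : ¬ (c.1 = b.2 ∧ c.2 = b.1) := fun h => hc (Prod.ext h.1 h.2)
    by_cases h : c.1 = b.2 <;> simp_all [superPerm]
  · simp

theorem superPerm_mul_firstLeg (p : I → ZMod 2) (X : Matrix I I A) :
    superPerm A p * firstLeg X = signOp A p * secondLeg X * signOp A p * superPerm A p := by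
  ext a b
  rw [superPerm_mul_apply, mul_superPerm_apply, signOp_eq_diagonal, Matrix.mul_diagonal,
    Matrix.diagonal_mul, mul_assoc, ← map_mul]
  simp [firstLeg, secondLeg, mul_comm (p b.2), sg_mul_self]

theorem firstLeg_mul_superPerm (p : I → ZMod 2) (X : Matrix I I A) :
    firstLeg X * superPerm A p = superPerm A p * (signOp A p * secondLeg X * signOp A p) := by
  ext a b
  rw [superPerm_mul_apply, mul_superPerm_apply, signOp_eq_diagonal, Matrix.mul_diagonal,
    Matrix.diagonal_mul, ← mul_assoc, ← mul_assoc, ← map_mul]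
  simp [firstLeg, secondLeg, mul_comm (p a.2), sg_mul_self]

end GradedOperators

/-- If the matrix G of osp generators satisfies the osp commutation relations, the
K-symmetry condition and the quadratic characteristic identity, then the linear
L-operator L(u) = (u+α)·Id + G satisfies the graded RLL relation for every α. -/
theorem linear_evaluation_RLL
    (n : ℕ) (p : Fin n → ZMod 2) (ε : ℂ) (hε : ε = 1 ∨ ε = -1)
    (εlo εhi : Matrix (Fin n) (Fin n) ℂ)
    (hlo0 : ∀ a b, p a + p b ≠ 0 → εlo a b = 0)
    (hhi0 : ∀ a b, p a + p b ≠ 0 → εhi a b = 0)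
    (hlosym : ∀ a b, εlo a b = ε * sg (p a * p b) * εlo b a)
    (hhisym : ∀ a b, εhi a b = ε * sg (p a * p b) * εhi b a)
    (hinv1 : ∀ a c, (∑ b, εhi a b * εlo b c) = if a = c then 1 else 0)
    (hinv2 : ∀ a c, (∑ b, εlo a b * εhi b c) = if a = c then 1 else 0)
    (A : Type*) [Ring A] [Algebra ℂ A]
    (G : Matrix (Fin n) (Fin n) A)
    (hω : (∑ a, ∑ b, εhi a b * εlo a b) ≠ 0)
    -- (a) osp supercommutation relations
    (ha : (Matrix.of fun (a : Fin n × Fin n) (b : Fin n × Fin n) =>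
          (if a.2 = b.2 then G a.1 b.1 else 0)) *
        ((Matrix.of fun a b => algebraMap ℂ A (sg (p a.1 * p a.2) * (if a = b then 1 else 0))) *
          (Matrix.of fun (a : Fin n × Fin n) (b : Fin n × Fin n) =>
            (if a.1 = b.1 then G a.2 b.2 else 0)) *
          (Matrix.of fun a b => algebraMap ℂ A (sg (p a.1 * p a.2) * (if a = b then 1 else 0)))) -
        ((Matrix.of fun a b => algebraMap ℂ A (sg (p a.1 * p a.2) * (if a = b then 1 else 0))) *
          (Matrix.of fun (a : Fin n × Fin n) (b : Fin n × Fin n) =>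
            (if a.1 = b.1 then G a.2 b.2 else 0)) *
          (Matrix.of fun a b => algebraMap ℂ A (sg (p a.1 * p a.2) * (if a = b then 1 else 0)))) *
        (Matrix.of fun (a : Fin n × Fin n) (b : Fin n × Fin n) =>
          (if a.2 = b.2 then G a.1 b.1 else 0)) =
      (ε • (Matrix.of fun (a : Fin n × Fin n) (b : Fin n × Fin n) => algebraMap ℂ A
            (sg (p a.1 * p a.2) * (if a.1 = b.2 then 1 else 0) * (if a.2 = b.1 then 1 else 0))) -
          (Matrix.of fun (a : Fin n × Fin n) (b : Fin n × Fin n) =>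
            algebraMap ℂ A (εhi a.1 a.2 * εlo b.1 b.2))) *
        ((Matrix.of fun a b => algebraMap ℂ A (sg (p a.1 * p a.2) * (if a = b then 1 else 0))) *
          (Matrix.of fun (a : Fin n × Fin n) (b : Fin n × Fin n) =>
            (if a.1 = b.1 then G a.2 b.2 else 0)) *
          (Matrix.of fun a b => algebraMap ℂ A (sg (p a.1 * p a.2) * (if a = b then 1 else 0)))) -
        ((Matrix.of fun a b => algebraMap ℂ A (sg (p a.1 * p a.2) * (if a = b then 1 else 0))) *
          (Matrix.of fun (a : Fin n × Fin n) (b : Fin n × Fin n) =>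
            (if a.1 = b.1 then G a.2 b.2 else 0)) *
          (Matrix.of fun a b => algebraMap ℂ A (sg (p a.1 * p a.2) * (if a = b then 1 else 0)))) *
        (ε • (Matrix.of fun (a : Fin n × Fin n) (b : Fin n × Fin n) => algebraMap ℂ A
            (sg (p a.1 * p a.2) * (if a.1 = b.2 then 1 else 0) * (if a.2 = b.1 then 1 else 0))) -
          (Matrix.of fun (a : Fin n × Fin n) (b : Fin n × Fin n) =>
            algebraMap ℂ A (εhi a.1 a.2 * εlo b.1 b.2))))
    -- (b) K-symmetry condition
    (hb1 : (Matrix.of fun (a : Fin n × Fin n) (b : Fin n × Fin n) =>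
          algebraMap ℂ A (εhi a.1 a.2 * εlo b.1 b.2)) *
        ((Matrix.of fun (a : Fin n × Fin n) (b : Fin n × Fin n) =>
            (if a.2 = b.2 then G a.1 b.1 else 0)) +
          (Matrix.of fun a b => algebraMap ℂ A (sg (p a.1 * p a.2) * (if a = b then 1 else 0))) *
            (Matrix.of fun (a : Fin n × Fin n) (b : Fin n × Fin n) =>
              (if a.1 = b.1 then G a.2 b.2 else 0)) *
            (Matrix.of fun a b => algebraMap ℂ A (sg (p a.1 * p a.2) * (if a = b then 1 else 0)))) = 0)
    (hb2 : ((Matrix.of fun (a : Fin n × Fin n) (b : Fin n × Fin n) =>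
            (if a.2 = b.2 then G a.1 b.1 else 0)) +
          (Matrix.of fun a b => algebraMap ℂ A (sg (p a.1 * p a.2) * (if a = b then 1 else 0))) *
            (Matrix.of fun (a : Fin n × Fin n) (b : Fin n × Fin n) =>
              (if a.1 = b.1 then G a.2 b.2 else 0)) *
            (Matrix.of fun a b => algebraMap ℂ A (sg (p a.1 * p a.2) * (if a = b then 1 else 0)))) *
        (Matrix.of fun (a : Fin n × Fin n) (b : Fin n × Fin n) =>
          algebraMap ℂ A (εhi a.1 a.2 * εlo b.1 b.2)) = 0)
    -- (c) quadratic characteristic identity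
    (hc : G * G + (1 - (∑ a, ∑ b, εhi a b * εlo a b) / 2) • G -
        (ε / (∑ a, ∑ b, εhi a b * εlo a b)) •
          ((∑ a, sg (p a) • (G * G) a a) • (1 : Matrix (Fin n) (Fin n) A)) = 0) :
    ∀ α u v : ℂ,
      let ω : ℂ := ∑ a, ∑ b, εhi a b * εlo a b
      let β : ℂ := 1 - ω / 2
      let PA : Matrix (Fin n × Fin n) (Fin n × Fin n) A :=
        Matrix.of fun a b => algebraMap ℂ A
          (sg (p a.1 * p a.2) * (if a.1 = b.2 then 1 else 0) * (if a.2 = b.1 then 1 else 0))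
      let KA : Matrix (Fin n × Fin n) (Fin n × Fin n) A :=
        Matrix.of fun a b => algebraMap ℂ A (εhi a.1 a.2 * εlo b.1 b.2)
      let SgA : Matrix (Fin n × Fin n) (Fin n × Fin n) A :=
        Matrix.of fun a b => algebraMap ℂ A (sg (p a.1 * p a.2) * (if a = b then 1 else 0))
      let RA : ℂ → Matrix (Fin n × Fin n) (Fin n × Fin n) A := fun w =>
        (w * (w + β)) • (1 : Matrix (Fin n × Fin n) (Fin n × Fin n) A) -
          (ε * (w + β)) • PA + w • KA
      let L : ℂ → Matrix (Fin n) (Fin n) A := fun w =>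
        (w + α) • (1 : Matrix (Fin n) (Fin n) A) + G
      let L1 : ℂ → Matrix (Fin n × Fin n) (Fin n × Fin n) A := fun w =>
        Matrix.of fun a b => if a.2 = b.2 then L w a.1 b.1 else 0
      let L2 : ℂ → Matrix (Fin n × Fin n) (Fin n × Fin n) A := fun w =>
        Matrix.of fun a b => if a.1 = b.1 then L w a.2 b.2 else 0
      RA (u - v) * L1 u * (SgA * L2 v * SgA) = (SgA * L2 v * SgA) * L1 u * RA (u - v) := by
  intro α u v ω β PA KA SgA RA L L1 L2
  have hSS : SgA * SgA = 1 := signOp_mul_self A p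
  set X := firstLeg G
  set Y := SgA * secondLeg G * SgA with hY
  have hL1 : L1 u = (u + α) • (1 : Matrix (Fin n × Fin n) (Fin n × Fin n) A) + X :=
    firstLeg_smul_one_add _ _
  have hL2 : SgA * L2 v * SgA =
      (v + α) • (1 : Matrix (Fin n × Fin n) (Fin n × Fin n) A) + Y := by
    have h : L2 v = (v + α) • (1 : Matrix (Fin n × Fin n) (Fin n × Fin n) A) + secondLeg G :=
      secondLeg_smul_one_add _ _
    rw [h, mul_add, add_mul, mul_smul_comm, smul_mul_assoc, mul_one, hSS]
  have hYY : Y * Y + β • Y =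
      SgA * (secondLeg G * secondLeg G + β • secondLeg G) * SgA := by
    have h : Y * Y = SgA * secondLeg G * (SgA * SgA) * secondLeg G * SgA := by
      simp only [hY, mul_assoc]
    rw [h, hSS, mul_one, mul_add, add_mul, mul_smul_comm, smul_mul_assoc, mul_assoc SgA]
  obtain ⟨c, hGG⟩ : ∃ c : A, G * G + β • G = c • (1 : Matrix (Fin n) (Fin n) A) :=
    ⟨(ε / ω) • ∑ a, sg (p a) • (G * G) a a, by rw [smul_assoc]; exact sub_eq_zero.mp hc⟩
  have hcentral : ∀ f : Fin n × Fin n → Fin n × Fin n → ℂ,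
      (Matrix.of fun a b => algebraMap ℂ A (f a b)) *
          (c • (1 : Matrix (Fin n × Fin n) (Fin n × Fin n) A)) =
        (c • (1 : Matrix (Fin n × Fin n) (Fin n × Fin n) A)) *
          (Matrix.of fun a b => algebraMap ℂ A (f a b)) := by
    intro f
    ext a b
    rw [Matrix.smul_one_eq_diagonal, Matrix.mul_diagonal, Matrix.diagonal_mul]
    exact Algebra.commutes _ _
  have hscalar : Y * Y + β • Y = c • (1 : Matrix (Fin n × Fin n) (Fin n × Fin n) A) := by
    rw [hYY, secondLeg_mul_self_add_smul, hGG, secondLeg_smul_one, hcentral, mul_assoc, hSS,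
      mul_one]
  have key := rll_of_relations (superPerm_mul_firstLeg p G) (firstLeg_mul_superPerm p G)
    ha hb1 hb2 (β := β) (by exact hscalar ▸ hcentral _) (u + α) (v + α)
  rw [add_sub_add_right_eq_sub] at key
  rw [hL1, hL2]
  exact key
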